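/- arXiv:1808.10435 — 2 statements merged into one kernel-verified Lean document; each statement's English description precedes it below -/
import Mathlib

section
/- Let K ⊆ ℝ^n be a symmetric convex body and suppose f : [0,∞) → [0,∞) is continuous with ∫_{ℝ^n} f(‖x‖_K) dx = 1. Let Z be a random vector in ℝ^n with density x ↦ f(‖x‖_K), and let U be uniform on [0,1] and independent of Z. Then: (i) Z/‖Z‖_K is distributed according to the cone probability measure μ_K on ∂K; (ii) U^{1/n} · Z/‖Z‖_K is distributed according to the uniform probability measure ν_K on K; (iii) Z/‖Z‖_K is independent of ‖Z‖_K. -/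
open MeasureTheory Set
open scoped ENNReal

/-- The cone `[0,1]B = {r • b : r ∈ [0,1], b ∈ B}`. -/
def coneSet {n : ℕ} (B : Set (Fin n → ℝ)) : Set (Fin n → ℝ) :=
  Set.image2 (· • ·) (Icc (0 : ℝ) 1) B

/-- A set stable under positive scalings has measure `r ^ dim E` times that of its intersection
with the unit ball of `g` inside the `r`-ball of `g`. -/
theorem measure_cone_inter_preimage_Iic {E : Type*} [NormedAddCommGroup E] [NormedSpace ℝ E]
    [FiniteDimensional ℝ E] [MeasurableSpace E] [BorelSpace E] (μ : Measure E)
    [μ.IsAddHaarMeasure] {g : E → ℝ} (hgs : ∀ r : ℝ, 0 ≤ r → ∀ x, g (r • x) = r * g x)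
    {C : Set E} (hC : ∀ r : ℝ, 0 < r → ∀ x, r • x ∈ C ↔ x ∈ C) {r : ℝ} (hr : 0 < r) :
    μ (C ∩ g ⁻¹' Iic r) = ENNReal.ofReal (r ^ Module.finrank ℝ E) * μ (C ∩ g ⁻¹' Iic 1) := by
  rw [← Measure.addHaar_smul_of_nonneg μ hr.le]
  congr 1
  ext x
  rw [mem_smul_set_iff_inv_smul_mem₀ hr.ne']
  simp only [mem_inter_iff, mem_preimage, mem_Iic, hC _ (inv_pos.2 hr), hgs _ (inv_pos.2 hr).le]
  rw [inv_mul_le_iff₀ hr, mul_one]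

/-- The zero set of a positively homogeneous function with unit ball of finite measure is null. -/
theorem measure_preimage_Iic_zero {E : Type*} [NormedAddCommGroup E] [NormedSpace ℝ E]
    [FiniteDimensional ℝ E] [Nontrivial E] [MeasurableSpace E] [BorelSpace E] (μ : Measure E)
    [μ.IsAddHaarMeasure] {g : E → ℝ} (hgs : ∀ r : ℝ, 0 ≤ r → ∀ x, g (r • x) = r * g x)
    (hfin : μ (g ⁻¹' Iic 1) ≠ ∞) :
    μ (g ⁻¹' Iic 0) = 0 := by
  have hsub : ∀ r : ℝ, 0 < r → g ⁻¹' Iic 0 ∩ g ⁻¹' Iic r = g ⁻¹' Iic 0 := fun r hr =>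
    inter_eq_left.2 fun x hx => le_trans (mem_Iic.1 hx) hr.le
  have h := measure_cone_inter_preimage_Iic μ hgs (C := g ⁻¹' Iic 0) (fun r hr x => by
    simp [hgs r hr.le, mul_nonpos_iff_pos_imp_nonpos, hr, hr.le]) (r := 2) two_pos
  rw [hsub 2 two_pos, hsub 1 one_pos] at h
  by_contra h0
  have htop : μ (g ⁻¹' Iic 0) ≠ ∞ :=
    ne_top_of_le_ne_top hfin (measure_mono (preimage_mono (Iic_subset_Iic.2 zero_le_one)))
  have h1 : (1 : ℝ≥0∞) < ENNReal.ofReal (2 ^ Module.finrank ℝ E) := by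
    rw [ENNReal.one_lt_ofReal]
    exact one_lt_pow₀ one_lt_two Module.finrank_pos.ne'
  have := ENNReal.mul_lt_mul_left h0 htop h1
  rw [one_mul, ← h] at this
  exact lt_irrefl _ this

/-- Generalized polar coordinates: on a cone `C`, the distribution of `g` is proportional to its
distribution on the whole space. -/
theorem map_restrict_cone {E : Type*} [NormedAddCommGroup E] [NormedSpace ℝ E]
    [FiniteDimensional ℝ E] [Nontrivial E] [MeasurableSpace E] [BorelSpace E] (μ : Measure E)
    [μ.IsAddHaarMeasure] {g : E → ℝ} (hg : Measurable g)
    (hgs : ∀ r : ℝ, 0 ≤ r → ∀ x, g (r • x) = r * g x) (hfin : μ (g ⁻¹' Iic 1) ≠ ∞)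
    {C : Set E} (hC : ∀ r : ℝ, 0 < r → ∀ x, r • x ∈ C ↔ x ∈ C) :
    μ (g ⁻¹' Iic 1) • (μ.restrict C).map g = μ (C ∩ g ⁻¹' Iic 1) • μ.map g := by
  have hle : μ (C ∩ g ⁻¹' Iic 1) ≤ μ (g ⁻¹' Iic 1) := measure_mono inter_subset_right
  have huniv : ∀ r : ℝ, 0 < r → μ (g ⁻¹' Iic r) =
      ENNReal.ofReal (r ^ Module.finrank ℝ E) * μ (g ⁻¹' Iic 1) := fun r hr => by
    simpa using measure_cone_inter_preimage_Iic μ hgs (C := univ) (by simp) hr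
  have happ : ∀ r : ℝ, (μ.restrict C).map g (Iic r) = μ (C ∩ g ⁻¹' Iic r) := fun r => by
    rw [Measure.map_apply hg measurableSet_Iic, Measure.restrict_apply (hg measurableSet_Iic),
      inter_comm]
  refine Measure.ext_of_generateFrom_of_iUnion (range Iic) (fun k : ℕ => Iic (k + 1 : ℝ))
    (borel_eq_generateFrom_Iic ℝ ▸ BorelSpace.measurable_eq) isPiSystem_Iic ?_ (by simp) ?_ ?_
  · exact iUnion_eq_univ_iff.2 fun x => ⟨⌊x⌋₊, (Nat.lt_floor_add_one x).le⟩
  · intro k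
    rw [Measure.smul_apply, happ, smul_eq_mul,
      measure_cone_inter_preimage_Iic μ hgs hC k.cast_add_one_pos]
    exact ENNReal.mul_ne_top hfin
      (ENNReal.mul_ne_top ENNReal.ofReal_ne_top (ne_top_of_le_ne_top hfin hle))
  · rintro _ ⟨r, rfl⟩
    rw [Measure.smul_apply, Measure.smul_apply, happ, Measure.map_apply hg measurableSet_Iic,
      smul_eq_mul, smul_eq_mul]
    rcases lt_or_ge 0 r with hr | hr
    · rw [measure_cone_inter_preimage_Iic μ hgs hC hr, huniv r hr]
      ring
    · have h0 : μ (g ⁻¹' Iic r) = 0 :=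
        measure_mono_null (preimage_mono (Iic_subset_Iic.2 hr))
          (measure_preimage_Iic_zero μ hgs hfin)
      rw [h0, measure_mono_null inter_subset_right h0]
      simp

/-- For a measure with density depending on `g` only, membership in a cone is independent of
`g`. -/
theorem withDensity_cone_inter_preimage {E : Type*} [NormedAddCommGroup E] [NormedSpace ℝ E]
    [FiniteDimensional ℝ E] [Nontrivial E] [MeasurableSpace E] [BorelSpace E] (μ : Measure E)
    [μ.IsAddHaarMeasure] {g : E → ℝ} (hg : Measurable g)
    (hgs : ∀ r : ℝ, 0 ≤ r → ∀ x, g (r • x) = r * g x) (hfin : μ (g ⁻¹' Iic 1) ≠ ∞)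
    (hpos : μ (g ⁻¹' Iic 1) ≠ 0) {ρ : ℝ → ℝ≥0∞} (hρ : Measurable ρ)
    {C : Set E} (hCm : MeasurableSet C) (hC : ∀ r : ℝ, 0 < r → ∀ x, r • x ∈ C ↔ x ∈ C)
    {T : Set ℝ} (hT : MeasurableSet T) :
    μ.withDensity (fun x => ρ (g x)) (C ∩ g ⁻¹' T) =
      μ (C ∩ g ⁻¹' Iic 1) / μ (g ⁻¹' Iic 1) * μ.withDensity (fun x => ρ (g x)) (g ⁻¹' T) := by
  have h := congrArg (fun ν => ∫⁻ r in T, ρ r ∂ν) (map_restrict_cone μ hg hgs hfin hC)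
  simp only [Measure.restrict_smul, lintegral_smul_measure, smul_eq_mul] at h
  rw [setLIntegral_map hT hρ hg, setLIntegral_map hT hρ hg,
    Measure.restrict_restrict (hg hT)] at h
  rw [withDensity_apply _ (hCm.inter (hg hT)), withDensity_apply _ (hg hT), inter_comm C,
    ENNReal.div_eq_inv_mul, mul_assoc, ← h, ← mul_assoc, ENNReal.inv_mul_cancel hpos hfin, one_mul]

/-- The radial projection is invariant under positive scalings. -/
theorem radialProj_smul {E : Type*} [AddCommGroup E] [Module ℝ E] {g : E → ℝ}
    (hgs : ∀ r : ℝ, 0 ≤ r → ∀ x, g (r • x) = r * g x) {r : ℝ} (hr : 0 < r) (x : E) :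
    (g (r • x))⁻¹ • r • x = (g x)⁻¹ • x := by
  rw [hgs r hr.le, smul_smul, mul_inv_rev, mul_assoc, inv_mul_cancel₀ hr.ne', mul_one]

/-- For a measure with density depending on `g` only, the joint law of the radial projection and
of `g` factors, and the law of the radial projection is the cone measure. -/
theorem withDensity_radialProj_inter {E : Type*} [NormedAddCommGroup E] [NormedSpace ℝ E]
    [FiniteDimensional ℝ E] [Nontrivial E] [MeasurableSpace E] [BorelSpace E] (μ : Measure E)
    [μ.IsAddHaarMeasure] {g : E → ℝ} (hg : Measurable g)
    (hgs : ∀ r : ℝ, 0 ≤ r → ∀ x, g (r • x) = r * g x) (hfin : μ (g ⁻¹' Iic 1) ≠ ∞)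
    (hpos : μ (g ⁻¹' Iic 1) ≠ 0) {ρ : ℝ → ℝ≥0∞} (hρ : Measurable ρ)
    {B : Set E} (hB : MeasurableSet B) {T : Set ℝ} (hT : MeasurableSet T) :
    μ.withDensity (fun x => ρ (g x)) ((fun x => (g x)⁻¹ • x) ⁻¹' B ∩ g ⁻¹' T) =
      μ ((fun x => (g x)⁻¹ • x) ⁻¹' B ∩ g ⁻¹' Iic 1) / μ (g ⁻¹' Iic 1) *
        μ.withDensity (fun x => ρ (g x)) (g ⁻¹' T) :=
  have hΘ : Measurable fun x => (g x)⁻¹ • x := hg.inv.smul measurable_id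
  withDensity_cone_inter_preimage μ hg hgs hfin hpos hρ (hΘ hB)
    (fun r hr x => by simp only [mem_preimage, radialProj_smul hgs hr]) hT

/-- If `U` is uniform on `[0,1]`, then `U ^ (1 / dim E)` is distributed like `g` under the uniform
measure on the unit ball of `g`. -/
theorem map_rpow_uniform_eq_map_cond {E : Type*} [NormedAddCommGroup E] [NormedSpace ℝ E]
    [FiniteDimensional ℝ E] [Nontrivial E] [MeasurableSpace E] [BorelSpace E] (μ : Measure E)
    [μ.IsAddHaarMeasure] {g : E → ℝ} (hg : Measurable g)
    (hgs : ∀ r : ℝ, 0 ≤ r → ∀ x, g (r • x) = r * g x) (hfin : μ (g ⁻¹' Iic 1) ≠ ∞)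
    (hpos : μ (g ⁻¹' Iic 1) ≠ 0) :
    (volume.restrict (Icc (0 : ℝ) 1)).map (fun u => u ^ ((Module.finrank ℝ E : ℝ)⁻¹)) =
      (ProbabilityTheory.cond μ (g ⁻¹' Iic 1)).map g := by
  have hd : 0 < Module.finrank ℝ E := Module.finrank_pos
  have hd' : (0 : ℝ) < Module.finrank ℝ E := Nat.cast_pos.2 hd
  have hm : Measurable fun u : ℝ => u ^ ((Module.finrank ℝ E : ℝ)⁻¹) := by fun_prop
  refine Measure.ext_of_Iic _ _ fun r => ?_
  rw [Measure.map_apply hm measurableSet_Iic, Measure.map_apply hg measurableSet_Iic,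
    Measure.restrict_apply (hm measurableSet_Iic),
    ProbabilityTheory.cond_apply (hg measurableSet_Iic), ← preimage_inter, Iic_inter_Iic]
  rcases lt_or_ge 0 r with hr | hr
  · have hmin : 0 < min 1 r := lt_min one_pos hr
    have huniv := measure_cone_inter_preimage_Iic μ hgs (C := univ) (by simp) hmin
    rw [univ_inter, univ_inter] at huniv
    have hset : (fun u : ℝ => u ^ ((Module.finrank ℝ E : ℝ)⁻¹)) ⁻¹' Iic r ∩ Icc 0 1 =
        Icc 0 (min 1 r ^ Module.finrank ℝ E) := by
      ext u
      simp only [mem_inter_iff, mem_preimage, mem_Iic, mem_Icc]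
      have key : 0 ≤ u → (u ≤ min 1 r ^ Module.finrank ℝ E ↔
          u ≤ 1 ∧ u ^ ((Module.finrank ℝ E : ℝ)⁻¹) ≤ r) := fun hu => by
        rw [← Real.rpow_natCast, ← Real.rpow_inv_le_iff_of_pos hu hmin.le hd', le_min_iff,
          Real.rpow_inv_le_iff_of_pos hu zero_le_one hd', Real.one_rpow]
      tauto
    rw [hset, Real.volume_Icc, sub_zero, huniv, mul_comm, mul_assoc,
      ENNReal.mul_inv_cancel hpos hfin, mul_one]
  · have h0 : μ (g ⁻¹' Iic (min 1 r)) = 0 :=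
      measure_mono_null (preimage_mono (Iic_subset_Iic.2 ((min_le_right _ _).trans hr)))
        (measure_preimage_Iic_zero μ hgs hfin)
    rw [h0, mul_zero]
    refine measure_mono_null (t := {0}) ?_ Real.volume_singleton
    rintro u ⟨hu, hu0, -⟩
    by_contra hne
    exact (Real.rpow_pos_of_pos (lt_of_le_of_ne hu0 (Ne.symm hne)) _).not_ge (le_trans hu hr)

/-- Under the uniform measure on the unit ball of `g`, the function `g` and the radial projection
are independent. -/
theorem map_prodMk_radialProj_cond {E : Type*} [NormedAddCommGroup E] [NormedSpace ℝ E]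
    [FiniteDimensional ℝ E] [Nontrivial E] [MeasurableSpace E] [BorelSpace E] (μ : Measure E)
    [μ.IsAddHaarMeasure] {g : E → ℝ} (hg : Measurable g)
    (hgs : ∀ r : ℝ, 0 ≤ r → ∀ x, g (r • x) = r * g x) (hfin : μ (g ⁻¹' Iic 1) ≠ ∞)
    (hpos : μ (g ⁻¹' Iic 1) ≠ 0) :
    (ProbabilityTheory.cond μ (g ⁻¹' Iic 1)).map (fun x => (g x, (g x)⁻¹ • x)) =
      ((ProbabilityTheory.cond μ (g ⁻¹' Iic 1)).map g).prod
        ((ProbabilityTheory.cond μ (g ⁻¹' Iic 1)).map fun x => (g x)⁻¹ • x) := by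
  have hΘ : Measurable fun x => (g x)⁻¹ • x := hg.inv.smul measurable_id
  refine (Measure.prod_eq fun T B hT hB => ?_).symm
  have h := withDensity_radialProj_inter μ hg hgs hfin hpos (ρ := fun _ => 1) measurable_const hB
    (measurableSet_Iic.inter hT : MeasurableSet (Iic 1 ∩ T))
  have h1 : μ.withDensity (fun _ => 1) = μ := withDensity_one
  rw [h1] at h
  rw [Measure.map_apply hg hT, Measure.map_apply hΘ hB,
    Measure.map_apply (hg.prodMk hΘ) (hT.prod hB),
    ProbabilityTheory.cond_apply (hg measurableSet_Iic),
    ProbabilityTheory.cond_apply (hg measurableSet_Iic),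
    ProbabilityTheory.cond_apply (hg measurableSet_Iic), mk_preimage_prod, ← inter_assoc,
    ← preimage_inter, inter_comm (g ⁻¹' _) (_ ⁻¹' B), inter_comm (g ⁻¹' Iic 1) (_ ⁻¹' B), h,
    ENNReal.div_eq_inv_mul]
  ring

/-- For `B` in the unit sphere of `g`, the cone `[0,1]B` is, up to the origin, the part of the unit
ball of `g` whose radial projection lies in `B`. -/
theorem mem_coneSet_iff {n : ℕ} {g : (Fin n → ℝ) → ℝ} (hg0 : ∀ x, x ≠ 0 → 0 < g x)
    (hgs : ∀ r : ℝ, 0 ≤ r → ∀ x, g (r • x) = r * g x) {B : Set (Fin n → ℝ)}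
    (hB : ∀ x ∈ B, g x = 1) {x : Fin n → ℝ} (hx : x ≠ 0) :
    x ∈ coneSet B ↔ (g x)⁻¹ • x ∈ B ∧ g x ≤ 1 := by
  constructor
  · rintro ⟨t, ⟨ht0, ht1⟩, b, hb, rfl⟩
    have ht : t ≠ 0 := fun h => hx (by simp [h])
    simp only [hgs t ht0, hB b hb, mul_one, smul_smul, inv_mul_cancel₀ ht, one_smul]
    exact ⟨hb, ht1⟩
  · rintro ⟨hb, h1⟩
    refine ⟨g x, ⟨(hg0 x hx).le, h1⟩, _, hb, ?_⟩
    simp only [smul_smul, mul_inv_cancel₀ (hg0 x hx).ne', one_smul]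

/-- Schechtman–Zinn type representation for a symmetric convex body `K ⊆ ℝ^n`.
If `Z` has density `x ↦ f(‖x‖_K)` (with `f : [0,∞) → [0,∞)` continuous and of total
integral one) and `U` is uniform on `[0,1]` and independent of `Z`, then `Z/‖Z‖_K`
follows the cone probability measure `μ_K` on `∂K`, `U^{1/n} ⬝ Z/‖Z‖_K` follows the
uniform probability measure `ν_K` on `K`, and `Z/‖Z‖_K` is independent of `‖Z‖_K`.
Here `‖·‖_K` is the Minkowski functional (gauge) of `K`. -/
theorem schechtman_zinn_representation_convex_body
    (n : ℕ) (hn : 1 ≤ n) (K : Set (Fin n → ℝ))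
    (hKconv : Convex ℝ K) (hKcomp : IsCompact K)
    (hKsym : ∀ x ∈ K, -x ∈ K) (hKint : (interior K).Nonempty)
    (f : ℝ → ℝ) (hfcont : ContinuousOn f (Ici 0)) (hfnonneg : ∀ r ∈ Ici (0 : ℝ), 0 ≤ f r)
    (hfint : ∫ x : Fin n → ℝ, f (gauge K x) = 1)
    {Ω : Type*} [MeasurableSpace Ω] (P : Measure Ω) [IsProbabilityMeasure P]
    (Z : Ω → (Fin n → ℝ)) (U : Ω → ℝ) (hZ : Measurable Z) (hU : Measurable U)
    -- `Z` has density `x ↦ f(‖x‖_K)` with respect to Lebesgue measure: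
    (hZlaw : Measure.map Z P =
      volume.withDensity (fun x => ENNReal.ofReal (f (gauge K x))))
    -- `U` is uniform on `[0,1]`:
    (hUlaw : Measure.map U P = volume.restrict (Icc (0 : ℝ) 1))
    -- `U` and `Z` are independent:
    (hindep : ProbabilityTheory.IndepFun U Z P) :
    -- (i) `Z/‖Z‖_K` is distributed according to the cone measure `μ_K` on `∂K`:
    (∀ B : Set (Fin n → ℝ), MeasurableSet B → B ⊆ frontier K →
      P {ω | (gauge K (Z ω))⁻¹ • Z ω ∈ B} = volume (coneSet B) / volume K) ∧
    -- (ii) `U^{1/n} ⬝ Z/‖Z‖_K` is distributed according to the uniform measure `ν_K`: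
    (∀ A : Set (Fin n → ℝ), MeasurableSet A →
      P {ω | (U ω ^ ((n : ℝ)⁻¹)) • (gauge K (Z ω))⁻¹ • Z ω ∈ A} =
        volume (A ∩ K) / volume K) ∧
    -- (iii) `Z/‖Z‖_K` is independent of `‖Z‖_K`:
    ProbabilityTheory.IndepFun (fun ω => (gauge K (Z ω))⁻¹ • Z ω)
      (fun ω => gauge K (Z ω)) P := by
  have : Nonempty (Fin n) := Fin.pos_iff_nonempty.1 hn
  have hK0 : K ∈ nhds 0 := by
    obtain ⟨x, hx⟩ := hKint
    have hneg : -x ∈ K := hKsym x (interior_subset hx)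
    have h := hKconv.combo_interior_self_mem_interior hx hneg (a := 1 / 2) (b := 1 / 2)
      (by norm_num) (by norm_num) (by norm_num)
    rw [smul_neg, add_neg_cancel] at h
    exact mem_interior_iff_mem_nhds.1 h
  have hgc : Continuous (gauge K) := continuous_gauge hKconv hK0
  have hg : Measurable (gauge K) := hgc.measurable
  have hgs : ∀ r : ℝ, 0 ≤ r → ∀ x, gauge K (r • x) = r * gauge K x := fun r hr x => by
    rw [gauge_smul_of_nonneg hr, smul_eq_mul]
  have hg0 : ∀ x, x ≠ 0 → 0 < gauge K x := fun x hx =>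
    (gauge_pos (absorbent_nhds_zero hK0)
      (NormedSpace.isVonNBounded_of_isBounded ℝ hKcomp.isBounded)).2 hx
  have hball : gauge K ⁻¹' Iic 1 = K := by
    ext x
    rw [mem_preimage, mem_Iic, gauge_le_one_iff_mem_closure hKconv hK0,
      hKcomp.isClosed.closure_eq]
  have hfin : volume (gauge K ⁻¹' Iic 1) ≠ ∞ := by
    rw [hball]
    exact hKcomp.measure_ne_top
  have hpos : volume (gauge K ⁻¹' Iic 1) ≠ 0 := by
    rw [hball]
    exact (Measure.measure_pos_of_mem_nhds volume hK0).ne'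
  have hΘ : Measurable fun x => (gauge K x)⁻¹ • x := hg.inv.smul measurable_id
  have hρ : Measurable fun r : ℝ => ENNReal.ofReal (f (max r 0)) :=
    (hfcont.comp_continuous (by fun_prop) fun r => le_max_right r 0).measurable.ennreal_ofReal
  have hjoint : ∀ (B : Set (Fin n → ℝ)) (T : Set ℝ), MeasurableSet B → MeasurableSet T →
      P ((fun ω => (gauge K (Z ω))⁻¹ • Z ω) ⁻¹' B ∩ (fun ω => gauge K (Z ω)) ⁻¹' T) =
        volume ((fun x => (gauge K x)⁻¹ • x) ⁻¹' B ∩ K) / volume K *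
          P ((fun ω => gauge K (Z ω)) ⁻¹' T) := fun B T hB hT => by
    have h := withDensity_radialProj_inter volume hg hgs hfin hpos hρ hB hT
    simp only [max_eq_left (gauge_nonneg _)] at h
    rw [← hZlaw, Measure.map_apply hZ ((hΘ hB).inter (hg hT)), Measure.map_apply hZ (hg hT),
      hball] at h
    exact h
  have hdir : ∀ B : Set (Fin n → ℝ), MeasurableSet B →
      P ((fun ω => (gauge K (Z ω))⁻¹ • Z ω) ⁻¹' B) =
        volume ((fun x => (gauge K x)⁻¹ • x) ⁻¹' B ∩ K) / volume K := fun B hB => by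
    simpa using hjoint B univ hB MeasurableSet.univ
  refine ⟨fun B hB hBK => ?_, fun A hA => ?_, ?_⟩
  · refine (hdir B hB).trans ?_
    congr 1
    refine measure_congr ?_
    filter_upwards [compl_mem_ae_iff.2 (measure_singleton (μ := volume) (0 : Fin n → ℝ))] with x hx
    refine propext (Iff.symm ?_)
    have h := mem_coneSet_iff hg0 hgs
      (fun b hb => (gauge_eq_one_iff_mem_frontier hKconv hK0).2 (hBK hb)) (x := x) hx
    have hxK : x ∈ K ↔ gauge K x ≤ 1 := by rw [← mem_Iic, ← mem_preimage, hball]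
    rw [← hxK] at h
    exact h
  · have hΘZ : Measurable fun ω => (gauge K (Z ω))⁻¹ • Z ω := hΘ.comp hZ
    have hpow : Measurable fun u : ℝ => u ^ ((n : ℝ)⁻¹) := by fun_prop
    have hsmul : Measurable fun p : ℝ × (Fin n → ℝ) => p.1 • p.2 := by fun_prop
    have hlawU := map_rpow_uniform_eq_map_cond volume hg hgs hfin hpos
    rw [Module.finrank_fin_fun, ← hUlaw, Measure.map_map hpow hU] at hlawU
    have hlawΘ : P.map (fun ω => (gauge K (Z ω))⁻¹ • Z ω) =
        (ProbabilityTheory.cond volume (gauge K ⁻¹' Iic 1)).map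
          fun x => (gauge K x)⁻¹ • x := by
      ext B hB
      rw [Measure.map_apply hΘZ hB, Measure.map_apply hΘ hB, hdir B hB,
        ProbabilityTheory.cond_apply (hg measurableSet_Iic), hball, inter_comm,
        ENNReal.div_eq_inv_mul]
    have hind := (ProbabilityTheory.indepFun_iff_map_prod_eq_prod_map_map
      (hpow.comp hU).aemeasurable hΘZ.aemeasurable).1 (hindep.comp hpow hΘ)
    rw [hlawU, hlawΘ, ← map_prodMk_radialProj_cond volume hg hgs hfin hpos] at hind
    have h := congrArg (fun ν => ν ((fun p : ℝ × (Fin n → ℝ) => p.1 • p.2) ⁻¹' A)) hind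
    rw [Measure.map_apply ((hpow.comp hU).prodMk hΘZ) (hsmul hA),
      Measure.map_apply (hg.prodMk hΘ) (hsmul hA)] at h
    refine h.trans ?_
    have hid : (fun x => (gauge K x, (gauge K x)⁻¹ • x)) ⁻¹'
        ((fun p : ℝ × (Fin n → ℝ) => p.1 • p.2) ⁻¹' A) = A := by
      ext x
      rcases eq_or_ne x 0 with rfl | hx
      · simp
      · simp [smul_smul, (hg0 x hx).ne']
    rw [hid, ProbabilityTheory.cond_apply (hg measurableSet_Iic), hball, inter_comm,
      ENNReal.div_eq_inv_mul]
  · refine ProbabilityTheory.indepFun_iff_measure_inter_preimage_eq_mul.2 fun B T hB hT => ?_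
    rw [hjoint B T hB hT, hdir B hB]
end

section
/- Let 0 < p, q < ∞ with p ≠ q, and for each n let X^{(n)} be distributed according to the uniform measure ν_p^n on 𝔹_p^n. Then the random variables √n (n^{1/p−1/q} ‖X^{(n)}‖_q / m_{p,q} − 1) converge in distribution, as n → ∞, to a centred Gaussian random variable with variance σ²_{p,q} = C_p(q,q)/(q² M_p(q)²) − 2 C_p(p,q)/(p q M_p(q)) + C_p(p,p)/p². -/
open MeasureTheory Set Filter
open scoped ENNReal Topology

/-- The `q`-norm on `ℝ^n` (for `q ∈ (0,∞)`). -/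
noncomputable def pnorm {n : ℕ} (q : ℝ) (x : Fin n → ℝ) : ℝ :=
  (∑ i, |x i| ^ q) ^ (1 / q)

/-- The unit ball `𝔹_p^n`. -/
def pBall (n : ℕ) (p : ℝ) : Set (Fin n → ℝ) := {x | pnorm p x ≤ 1}

/-- The uniform probability measure `ν_p^n` on `𝔹_p^n`. -/
noncomputable def nuMeasure (n : ℕ) (p : ℝ) : Measure (Fin n → ℝ) :=
  (volume (pBall n p))⁻¹ • volume.restrict (pBall n p)

/-- `M_p(q) = (p^{q/p}/(q+1)) Γ(1+(q+1)/p)/Γ(1+1/p)`, the `q`-th absolute moment of the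
`p`-generalized Gaussian distribution. -/
noncomputable def Mp (p q : ℝ) : ℝ :=
  p ^ (q / p) / (q + 1) * (Real.Gamma (1 + (q + 1) / p) / Real.Gamma (1 + 1 / p))

/-- `m_{p,q} = M_p(q)^{1/q}`. -/
noncomputable def mpq (p q : ℝ) : ℝ := Mp p q ^ (1 / q)

/-- `C_p(q,r) = M_p(q+r) − M_p(q) M_p(r)`. -/
noncomputable def Cp (p q r : ℝ) : ℝ := Mp p (q + r) - Mp p q * Mp p r

/-- `σ²_{p,q} = C_p(q,q)/(q² M_p(q)²) − 2 C_p(p,q)/(p q M_p(q)) + C_p(p,p)/p²`. -/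
noncomputable def sigmaSq (p q : ℝ) : ℝ :=
  Cp p q q / (q ^ 2 * Mp p q ^ 2) - 2 * Cp p p q / (p * q * Mp p q) + Cp p p p / p ^ 2

open ProbabilityTheory

/-- The density of the `p`-generalized Gaussian distribution. -/
noncomputable def genGaussPDF (p x : ℝ) : ℝ :=
  (2 * p ^ (1 / p) * Real.Gamma (1 + 1 / p))⁻¹ * Real.exp (-p⁻¹ * |x| ^ p)

/-- The `p`-generalized Gaussian distribution. -/
noncomputable def genGauss (p : ℝ) : Measure ℝ :=
  volume.withDensity fun x => ENNReal.ofReal (genGaussPDF p x)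

lemma genGaussPDF_nonneg {p : ℝ} (hp : 0 < p) (x : ℝ) : 0 ≤ genGaussPDF p x := by
  have := Real.Gamma_pos_of_pos (show 0 < 1 + 1 / p by positivity)
  unfold genGaussPDF
  positivity

@[fun_prop]
lemma measurable_genGaussPDF (p : ℝ) : Measurable (genGaussPDF p) := by
  unfold genGaussPDF
  fun_prop

lemma Mp_pos {p r : ℝ} (hp : 0 < p) (hr : 0 ≤ r) : 0 < Mp p r := by
  have h1 := Real.Gamma_pos_of_pos (show 0 < 1 + 1 / p by positivity)
  have h2 := Real.Gamma_pos_of_pos (show 0 < 1 + (r + 1) / p by positivity)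
  unfold Mp
  positivity

lemma Mp_zero {p : ℝ} (hp : 0 < p) : Mp p 0 = 1 := by
  have h1 := Real.Gamma_pos_of_pos (show 0 < 1 + 1 / p by positivity)
  simp only [Mp, zero_div, Real.rpow_zero, zero_add]
  field_simp

lemma Mp_self {p : ℝ} (hp : 0 < p) : Mp p p = 1 := by
  have h1 := Real.Gamma_pos_of_pos (show 0 < 1 + 1 / p by positivity)
  have h2 : 1 + (p + 1) / p = (1 + 1 / p) + 1 := by field_simp; ring
  rw [Mp, h2, Real.Gamma_add_one (by positivity), div_self hp.ne', Real.rpow_one]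
  field_simp

lemma integral_genGaussPDF_mul {p r : ℝ} (hp : 0 < p) (hr : 0 ≤ r) :
    ∫ x, genGaussPDF p x * |x| ^ r = Mp p r := by
  have h1 := Real.Gamma_pos_of_pos (show 0 < 1 + 1 / p by positivity)
  have h := integral_comp_abs (f := fun x : ℝ =>
    (2 * p ^ (1 / p) * Real.Gamma (1 + 1 / p))⁻¹ * (x ^ r * Real.exp (-p⁻¹ * x ^ p)))
  have h2 : ∀ x, genGaussPDF p x * |x| ^ r = (2 * p ^ (1 / p) * Real.Gamma (1 + 1 / p))⁻¹ *
      (|x| ^ r * Real.exp (-p⁻¹ * |x| ^ p)) := fun x => by rw [genGaussPDF]; ring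
  simp_rw [h2]
  rw [h, integral_const_mul, integral_rpow_mul_exp_neg_mul_rpow hp (by linarith) (by positivity),
    Mp, add_comm 1 ((r + 1) / p), Real.Gamma_add_one (by positivity), Real.inv_rpow hp.le,
    neg_div, Real.rpow_neg hp.le, inv_inv, add_div, Real.rpow_add hp]
  have := Real.rpow_pos_of_pos hp (1 / p)
  field_simp

lemma integrable_genGaussPDF_mul {p r : ℝ} (hp : 0 < p) (hr : 0 ≤ r) :
    Integrable fun x => genGaussPDF p x * |x| ^ r := by
  by_contra h
  exact (Mp_pos hp hr).ne' ((integral_genGaussPDF_mul hp hr).symm.trans (integral_undef h))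

lemma integrable_genGaussPDF {p : ℝ} (hp : 0 < p) : Integrable (genGaussPDF p) := by
  simpa using integrable_genGaussPDF_mul hp le_rfl

lemma isProbabilityMeasure_genGauss {p : ℝ} (hp : 0 < p) :
    IsProbabilityMeasure (genGauss p) := by
  constructor
  rw [genGauss, withDensity_apply _ MeasurableSet.univ, Measure.restrict_univ,
    ← ofReal_integral_eq_lintegral_ofReal (integrable_genGaussPDF hp)
      (ae_of_all _ (genGaussPDF_nonneg hp))]
  have := integral_genGaussPDF_mul hp (r := 0) le_rfl
  simp only [Real.rpow_zero, mul_one, Mp_zero hp] at this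
  simp [this]

lemma integral_genGauss {p : ℝ} (hp : 0 < p) (f : ℝ → ℝ) :
    ∫ x, f x ∂(genGauss p) = ∫ x, genGaussPDF p x * f x := by
  rw [genGauss, integral_withDensity_eq_integral_toReal_smul (by fun_prop) (by simp)]
  simp [ENNReal.toReal_ofReal (genGaussPDF_nonneg hp _)]

lemma integrable_genGauss_iff {p : ℝ} (hp : 0 < p) (f : ℝ → ℝ) :
    Integrable f (genGauss p) ↔ Integrable fun x => genGaussPDF p x * f x := by
  rw [genGauss, integrable_withDensity_iff_integrable_smul' (by fun_prop) (by simp)]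
  simp [ENNReal.toReal_ofReal (genGaussPDF_nonneg hp _)]

lemma integral_abs_rpow_genGauss {p r : ℝ} (hp : 0 < p) (hr : 0 ≤ r) :
    ∫ x, |x| ^ r ∂(genGauss p) = Mp p r := by
  rw [integral_genGauss hp, integral_genGaussPDF_mul hp hr]

lemma integrable_abs_rpow_genGauss {p r : ℝ} (hp : 0 < p) (hr : 0 ≤ r) :
    Integrable (fun x => |x| ^ r) (genGauss p) :=
  (integrable_genGauss_iff hp _).2 (integrable_genGaussPDF_mul hp hr)

lemma memLp_two_abs_rpow_genGauss {p r : ℝ} (hp : 0 < p) (hr : 0 ≤ r) :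
    MemLp (fun x => |x| ^ r) 2 (genGauss p) := by
  rw [memLp_two_iff_integrable_sq (by fun_prop)]
  have := integrable_abs_rpow_genGauss hp (show 0 ≤ r * 2 by positivity)
  refine this.congr (ae_of_all _ fun x => ?_)
  simp only
  rw [Real.rpow_mul (abs_nonneg x)]
  norm_cast

/-- The joint density of independent `p`-generalized Gaussian variables is the product of their
densities. -/
lemma pi_genGauss {p : ℝ} (hp : 0 < p) (n : ℕ) :
    Measure.pi (fun _ : Fin n => genGauss p) =
      volume.withDensity fun z : Fin n → ℝ => ENNReal.ofReal (∏ i, genGaussPDF p (z i)) := by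
  have := isProbabilityMeasure_genGauss hp
  refine (Measure.pi_eq fun s hs => ?_)
  rw [withDensity_apply _ (MeasurableSet.univ_pi hs),
    ← lintegral_indicator (MeasurableSet.univ_pi hs)]
  have h1 : ∀ i, genGauss p (s i)
      = ENNReal.ofReal (∫ x, (s i).indicator (genGaussPDF p) x) := by
    intro i
    rw [genGauss, withDensity_apply _ (hs i), ← lintegral_indicator (hs i),
      ofReal_integral_eq_lintegral_ofReal ((integrable_genGaussPDF hp).indicator (hs i))
        (ae_of_all _ fun x => indicator_nonneg (fun x _ => genGaussPDF_nonneg hp x) x)]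
    refine lintegral_congr fun x => ?_
    by_cases hx : x ∈ s i <;> simp [hx]
  simp_rw [h1]
  rw [← ENNReal.ofReal_prod_of_nonneg (fun i _ => integral_nonneg fun x =>
      indicator_nonneg (fun x _ => genGaussPDF_nonneg hp x) x),
    ← integral_fintype_prod_volume_eq_prod (fun i => (s i).indicator (genGaussPDF p)),
    ofReal_integral_eq_lintegral_ofReal]
  · refine lintegral_congr fun z => ?_
    by_cases hz : z ∈ univ.pi s
    · rw [indicator_of_mem hz]
      congr 1
      exact Finset.prod_congr rfl fun i _ => (indicator_of_mem (hz i trivial) _).symm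
    · rw [indicator_of_notMem hz]
      simp only [Set.mem_pi, Set.mem_univ, true_imp_iff, not_forall] at hz
      obtain ⟨i, hi⟩ := hz
      rw [Finset.prod_eq_zero (Finset.mem_univ i) (indicator_of_notMem hi _), ENNReal.ofReal_zero]
  · exact Integrable.fintype_prod fun i => (integrable_genGaussPDF hp).indicator (hs i)
  · exact ae_of_all _ fun z => Finset.prod_nonneg fun i _ =>
      indicator_nonneg (fun x _ => genGaussPDF_nonneg hp x) _

lemma eq_nuMeasure_of_eq_smul {n : ℕ} {p : ℝ} {μ : Measure (Fin n → ℝ)}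
    [IsProbabilityMeasure μ] {K : ℝ≥0∞} (h : μ = K • volume.restrict (pBall n p)) :
    μ = nuMeasure n p := by
  have h1 : K * volume (pBall n p) = 1 := by
    have := measure_univ (μ := μ)
    rw [h] at this
    simpa using this
  rw [nuMeasure, ← ENNReal.eq_inv_of_mul_eq_one_left h1, h]

lemma pnorm_le_one_iff {n : ℕ} {p : ℝ} (hp : 0 < p) (z : Fin n → ℝ) :
    pnorm p z ≤ 1 ↔ ∑ i, |z i| ^ p ≤ 1 := by
  have h : (0 : ℝ) ≤ ∑ i, |z i| ^ p := by positivity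
  rw [pnorm, ← Real.rpow_le_rpow_iff h zero_le_one (show 0 < 1 / p by positivity), Real.one_rpow]

lemma measurableSet_pBall (n : ℕ) (p : ℝ) : MeasurableSet (pBall n p) := by
  unfold pBall pnorm
  exact measurableSet_le (by fun_prop) (by fun_prop)

lemma sum_abs_rpow_smul {n : ℕ} {p t : ℝ} (hp : 0 < p) (ht : 0 < t) (z : Fin n → ℝ) :
    ∑ i, |(t ^ (-(1 / p)) • z) i| ^ p = (∑ i, |z i| ^ p) / t := by
  have h := Real.rpow_pos_of_pos ht (-(1 / p))
  rw [Finset.sum_div]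
  refine Finset.sum_congr rfl fun i _ => ?_
  rw [Pi.smul_apply, smul_eq_mul, abs_mul, abs_of_pos h, Real.mul_rpow h.le (abs_nonneg _),
    ← Real.rpow_mul ht.le, neg_mul, one_div_mul_cancel hp.ne', Real.rpow_neg_one]
  ring

lemma lintegral_comp_smul_pi {n : ℕ} {H : (Fin n → ℝ) → ℝ≥0∞} (hH : Measurable H) {r : ℝ}
    (hr : r ≠ 0) :
    ∫⁻ z, H (r • z) = ENNReal.ofReal |(r ^ n)⁻¹| * ∫⁻ z, H z := by
  have h := Measure.map_addHaar_smul (volume : Measure (Fin n → ℝ)) hr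
  rw [← lintegral_map (f := H) hH (by fun_prop), h, lintegral_smul_measure]
  simp

lemma prod_genGaussPDF {n : ℕ} (p : ℝ) (z : Fin n → ℝ) :
    ∏ i, genGaussPDF p (z i) = ((2 * p ^ (1 / p) * Real.Gamma (1 + 1 / p))⁻¹) ^ n *
      Real.exp (-p⁻¹ * ∑ i, |z i| ^ p) := by
  simp only [genGaussPDF]
  rw [Finset.prod_mul_distrib, ← Real.exp_sum, Finset.mul_sum]
  simp

/-- If `Z` has independent `p`-generalized Gaussian coordinates and `E` is an independent
exponential variable with mean `p`, then `Z / (‖Z‖_p ^ p + E) ^ (1 / p)` is uniformly distributed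
on the unit ball of the `p`-norm. -/
theorem map_prod_expMeasure_eq_nuMeasure {p : ℝ} (hp : 0 < p) (n : ℕ) :
    ((Measure.pi fun _ : Fin n => genGauss p).prod (expMeasure p⁻¹)).map
      (fun w => (∑ i, |w.1 i| ^ p + w.2) ^ (-(1 / p)) • w.1) = nuMeasure n p := by
  have := isProbabilityMeasure_genGauss hp
  have := isProbabilityMeasure_expMeasure (inv_pos.2 hp)
  have hmeas : Measurable fun w : (Fin n → ℝ) × ℝ =>
      (∑ i, |w.1 i| ^ p + w.2) ^ (-(1 / p)) • w.1 := by fun_prop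
  have := Measure.isProbabilityMeasure_map
    (μ := (Measure.pi fun _ : Fin n => genGauss p).prod (expMeasure p⁻¹)) hmeas.aemeasurable
  set c : ℝ := (2 * p ^ (1 / p) * Real.Gamma (1 + 1 / p))⁻¹ with hc
  have hc0 : 0 ≤ c := by
    have := Real.Gamma_pos_of_pos (show 0 < 1 + 1 / p by positivity)
    positivity
  let k : ℝ → ℝ≥0∞ := (Ioi 0).indicator fun t =>
    ENNReal.ofReal (c ^ n * p⁻¹ * Real.exp (-p⁻¹ * t)) *
    ENNReal.ofReal |((t ^ (-(1 / p))) ^ n)⁻¹|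
  have hk : Measurable k := by
    refine Measurable.indicator ?_ measurableSet_Ioi
    fun_prop
  refine eq_nuMeasure_of_eq_smul (K := ∫⁻ t, k t) ?_
  ext s hs
  rw [Measure.smul_apply, smul_eq_mul, Measure.restrict_apply hs, ← lintegral_indicator_one hs,
    ← lintegral_indicator_one (hs.inter (measurableSet_pBall n p)),
    lintegral_map (measurable_one.indicator hs) hmeas]
  set h : (Fin n → ℝ) → ℝ≥0∞ := s.indicator 1
  have hh : Measurable h := measurable_one.indicator hs
  have hcomp : Measurable fun w : (Fin n → ℝ) × ℝ =>
      h ((∑ i, |w.1 i| ^ p + w.2) ^ (-(1 / p)) • w.1) := hh.comp hmeas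
  set H : (Fin n → ℝ) → ℝ≥0∞ := (s ∩ pBall n p).indicator 1
  have hH : Measurable H := measurable_one.indicator (hs.inter (measurableSet_pBall n p))
  let F : (Fin n → ℝ) → ℝ → ℝ≥0∞ := fun z t =>
    ENNReal.ofReal (c ^ n * p⁻¹ * Real.exp (-p⁻¹ * t)) *
      ({w : (Fin n → ℝ) × ℝ | ∑ i, |w.1 i| ^ p ≤ w.2}.indicator 1 (z, t) *
        h (t ^ (-(1 / p)) • z))
  have hF : Measurable (Function.uncurry F) := by
    have h1 : MeasurableSet {w : (Fin n → ℝ) × ℝ | ∑ i, |w.1 i| ^ p ≤ w.2} :=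
      measurableSet_le (by fun_prop) (by fun_prop)
    have h2 : Measurable fun w : (Fin n → ℝ) × ℝ => h (w.2 ^ (-(1 / p)) • w.1) :=
      hh.comp (by fun_prop)
    refine Measurable.mul (by fun_prop) (Measurable.mul (measurable_one.indicator h1) h2)
  have hpdf : Measurable (exponentialPDF p⁻¹) := (measurable_exponentialPDFReal _).ennreal_ofReal
  have hexp : expMeasure p⁻¹ = volume.withDensity (exponentialPDF p⁻¹) := rfl
  rw [pi_genGauss hp, hexp, prod_withDensity (by fun_prop) hpdf,
    lintegral_withDensity_eq_lintegral_mul _ (by fun_prop) hcomp]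
  rw [lintegral_prod _ (by
    refine (Measurable.mul ?_ hcomp).aemeasurable
    exact Measurable.mul (by fun_prop) (hpdf.comp measurable_snd))]
  calc _ = ∫⁻ z : Fin n → ℝ, ∫⁻ e : ℝ, F z (∑ i, |z i| ^ p + e) := by
        refine lintegral_congr fun z => lintegral_congr fun e => ?_
        simp only [Pi.mul_apply, F, prod_genGaussPDF, ← hc,
          exponentialPDF_eq, indicator_apply, mem_ofPred_eq, le_add_iff_nonneg_right, Pi.one_apply]
        split_ifs
        · rw [← ENNReal.ofReal_mul (by positivity), one_mul]
          congr 2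
          rw [show -p⁻¹ * (∑ i, |z i| ^ p + e) = -p⁻¹ * ∑ i, |z i| ^ p + -(p⁻¹ * e) by ring,
            Real.exp_add]
          ring
        · simp
    _ = ∫⁻ z : Fin n → ℝ, ∫⁻ t : ℝ, F z t :=
        lintegral_congr fun z => lintegral_add_left_eq_self _ _
    _ = ∫⁻ t : ℝ, ∫⁻ z : Fin n → ℝ, F z t := lintegral_lintegral_swap hF.aemeasurable
    _ = ∫⁻ t, k t * ∫⁻ z, H z := by
        refine lintegral_congr_ae ?_
        have h0 : ∀ᵐ t : ℝ, t ≠ 0 := by simp [ae_iff]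
        filter_upwards [h0] with t ht
        rcases ht.lt_or_gt with ht | ht
        · have : ∀ z, F z t = 0 := fun z => by
            have : ¬ (∑ i, |z i| ^ p ≤ t) := not_le.2 (ht.trans_le (by positivity))
            simp [F, this]
          simp [this, k, ht.le]
        · have : ∀ z, F z t = ENNReal.ofReal (c ^ n * p⁻¹ * Real.exp (-p⁻¹ * t)) *
              H (t ^ (-(1 / p)) • z) := fun z => by
            have : t ^ (-(1 / p)) • z ∈ pBall n p ↔ ∑ i, |z i| ^ p ≤ t := by
              rw [pBall, mem_ofPred_eq, pnorm_le_one_iff hp, sum_abs_rpow_smul hp ht,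
                div_le_one ht]
            change _ * (_ * h _) = _
            congr 1
            by_cases h2 : ∑ i, |z i| ^ p ≤ t
            · rw [indicator_of_mem (mem_ofPred_eq ▸ h2 :
                (z, t) ∈ {w : (Fin n → ℝ) × ℝ | ∑ i, |w.1 i| ^ p ≤ w.2}), Pi.one_apply, one_mul]
              by_cases h1 : t ^ (-(1 / p)) • z ∈ s
              · rw [show h _ = 1 from indicator_of_mem h1 _,
                  show H _ = 1 from indicator_of_mem (mem_inter h1 (this.2 h2)) _]
              · rw [show h _ = 0 from indicator_of_notMem h1 _,
                  show H _ = 0 from indicator_of_notMem (fun hm => h1 hm.1) _]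
            · rw [indicator_of_notMem (show
                (z, t) ∉ {w : (Fin n → ℝ) × ℝ | ∑ i, |w.1 i| ^ p ≤ w.2} from h2), zero_mul,
                show H _ = 0 from indicator_of_notMem (fun hm => h2 (this.1 hm.2)) _]
          simp_rw [this]
          have h3 : t ^ (-(1 / p)) ≠ 0 := (Real.rpow_pos_of_pos ht _).ne'
          rw [lintegral_const_mul' _ _ ENNReal.ofReal_ne_top, lintegral_comp_smul_pi hH h3]
          simp [k, ht, mul_assoc]
    _ = _ := lintegral_mul_const _ hk

/-- A sequence of random vectors is bounded in probability. -/
def BoundedInProb {Ω E : Type*} [MeasurableSpace Ω] [Norm E] (μ : Measure Ω)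
    (V : ℕ → Ω → E) : Prop :=
  ∀ δ : ℝ≥0∞, 0 < δ → ∃ K : ℝ, ∀ᶠ n in atTop, μ {ω | K ≤ ‖V n ω‖} ≤ δ

lemma boundedInProb_of_tendstoInMeasure {Ω : Type*} [MeasurableSpace Ω] {μ : Measure Ω}
    {V : ℕ → Ω → ℝ} (h : TendstoInMeasure μ V atTop 0) : BoundedInProb μ V := by
  intro δ hδ
  refine ⟨1, ?_⟩
  have := ENNReal.tendsto_nhds_zero.1 (tendstoInMeasure_iff_norm.1 h 1 one_pos) δ hδ
  simpa using this

lemma BoundedInProb.add {Ω : Type*} [MeasurableSpace Ω] {μ : Measure Ω} {U V : ℕ → Ω → ℝ}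
    (hU : BoundedInProb μ U) (hV : BoundedInProb μ V) :
    BoundedInProb μ fun n ω => U n ω + V n ω := by
  intro δ hδ
  obtain ⟨K, hK⟩ := hU (δ / 2) (ENNReal.half_pos hδ.ne')
  obtain ⟨L, hL⟩ := hV (δ / 2) (ENNReal.half_pos hδ.ne')
  refine ⟨K + L, ?_⟩
  filter_upwards [hK, hL] with n h1 h2
  calc _ ≤ μ ({ω | K ≤ ‖U n ω‖} ∪ {ω | L ≤ ‖V n ω‖}) := by
        refine measure_mono fun ω (hω : K + L ≤ ‖U n ω + V n ω‖) => ?_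
        by_contra h
        rw [mem_union, not_or] at h
        have h3 : ‖U n ω‖ < K := not_le.1 h.1
        have h4 : ‖V n ω‖ < L := not_le.1 h.2
        linarith [norm_add_le (U n ω) (V n ω)]
    _ ≤ _ := measure_union_le _ _
    _ ≤ δ / 2 + δ / 2 := add_le_add h1 h2
    _ = δ := ENNReal.add_halves δ

lemma BoundedInProb.prodMk {Ω : Type*} [MeasurableSpace Ω] {μ : Measure Ω} {U V : ℕ → Ω → ℝ}
    (hU : BoundedInProb μ U) (hV : BoundedInProb μ V) :
    BoundedInProb μ fun n ω => (U n ω, V n ω) := by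
  intro δ hδ
  obtain ⟨K, hK⟩ := hU (δ / 2) (ENNReal.half_pos hδ.ne')
  obtain ⟨L, hL⟩ := hV (δ / 2) (ENNReal.half_pos hδ.ne')
  refine ⟨max K L, ?_⟩
  filter_upwards [hK, hL] with n h1 h2
  calc _ ≤ μ ({ω | K ≤ ‖U n ω‖} ∪ {ω | L ≤ ‖V n ω‖}) := by
        refine measure_mono fun ω (hω : max K L ≤ ‖(U n ω, V n ω)‖) => ?_
        rw [Prod.norm_mk, le_max_iff] at hω
        exact hω.imp (le_max_left _ _).trans (le_max_right _ _).trans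
    _ ≤ _ := measure_union_le _ _
    _ ≤ δ / 2 + δ / 2 := add_le_add h1 h2
    _ = δ := ENNReal.add_halves δ

/-- Normalized sums of independent identically distributed square integrable variables are bounded
in probability. -/
lemma boundedInProb_inv_sqrt_mul_sum_sub {Ω : Type*} [MeasurableSpace Ω] {μ : Measure Ω}
    [IsProbabilityMeasure μ] {X : ℕ → Ω → ℝ} (hX : MemLp (X 0) 2 μ) (hindep : iIndepFun X μ)
    (hident : ∀ i, IdentDistrib (X i) (X 0) μ μ) :
    BoundedInProb μ fun n ω => (√n)⁻¹ * (∑ k ∈ Finset.range n, X k ω - n * μ[X 0]) := by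
  have hXi : ∀ i, MemLp (X i) 2 μ := fun i => (hident i).symm.memLp_snd hX
  have hmean : ∀ n : ℕ, μ[∑ k ∈ Finset.range n, X k] = (n : ℝ) * μ[X 0] := fun n => by
    simp only [Finset.sum_apply]
    rw [integral_finsetSum _ fun i _ => (hXi i).integrable one_le_two]
    simp [(hident _).integral_eq]
  have hvar : ∀ n : ℕ, Var[∑ k ∈ Finset.range n, X k; μ] = n * Var[X 0; μ] := fun n => by
    rw [IndepFun.variance_sum (fun i _ => hXi i) fun i _ j _ hij => hindep.indepFun hij]
    simp [(hident _).variance_eq]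
  intro δ hδ
  have hlim : Tendsto (fun K : ℝ => ENNReal.ofReal (Var[X 0; μ] / K ^ 2)) atTop (𝓝 0) := by
    rw [← ENNReal.ofReal_zero]
    exact ENNReal.tendsto_ofReal
      (tendsto_const_nhds.div_atTop (tendsto_pow_atTop two_ne_zero))
  obtain ⟨K, hK, hK0⟩ :=
    ((ENNReal.tendsto_nhds_zero.1 hlim δ hδ).and (eventually_gt_atTop 0)).exists
  refine ⟨K, ?_⟩
  filter_upwards [eventually_gt_atTop 0] with n hn
  have hn' : (0 : ℝ) < n := by exact_mod_cast hn
  have hs : 0 < √(n : ℝ) := Real.sqrt_pos.2 hn'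
  have h := meas_ge_le_variance_div_sq (memLp_finsetSum' (Finset.range n) fun i _ => hXi i)
    (mul_pos hK0 hs)
  refine le_trans (measure_mono fun ω (hω : K ≤ _) => ?_) (h.trans ?_)
  · change K * √n ≤ _
    rw [hmean, Finset.sum_apply]
    rwa [norm_mul, norm_inv, Real.norm_of_nonneg hs.le, Real.norm_eq_abs, inv_mul_eq_div,
      le_div_iff₀ hs] at hω
  · rw [hvar, mul_pow, Real.sq_sqrt hn'.le]
    rwa [mul_comm (K ^ 2), mul_div_mul_left _ _ hn'.ne']

/-- The **delta method**: a differentiable function of random vectors converging at rate `1 / √n`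
may be replaced by its linearization. -/
lemma BoundedInProb.tendstoInMeasure_delta {Ω E : Type*} [MeasurableSpace Ω] {μ : Measure Ω}
    [NormedAddCommGroup E] [NormedSpace ℝ E] {V : ℕ → Ω → E} (hV : BoundedInProb μ V)
    {f : E → ℝ} {L : E →L[ℝ] ℝ} {x : E} (hf : HasFDerivAt f L x) :
    TendstoInMeasure μ (fun n : ℕ => fun ω =>
      √n * (f (x + (√n)⁻¹ • V n ω) - f x) - L (V n ω)) atTop 0 := by
  rw [tendstoInMeasure_iff_norm]
  intro ε hε
  rw [ENNReal.tendsto_nhds_zero]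
  intro δ hδ
  obtain ⟨K₀, hK₀⟩ := hV δ hδ
  obtain ⟨K, hKK, hK⟩ : ∃ K, K₀ ≤ K ∧ 0 < K := ⟨max K₀ 1, le_max_left _ _, by positivity⟩
  have ho := (hasFDerivAt_iff_isLittleO_nhds_zero.1 hf).def (show 0 < ε / (2 * K) by positivity)
  obtain ⟨η, hη, hball⟩ := Metric.eventually_nhds_iff.1 ho
  have hsq : Tendsto (fun n : ℕ => √(n : ℝ)) atTop atTop :=
    Real.tendsto_sqrt_atTop.comp tendsto_natCast_atTop_atTop
  filter_upwards [hK₀, hsq.eventually_gt_atTop (K / η), hsq.eventually_gt_atTop 0]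
    with n hn hnη hs
  refine le_trans (measure_mono fun ω hω => ?_) hn
  by_contra hlt
  have hVK : ‖V n ω‖ < K := (not_le.1 hlt).trans_le hKK
  have hnorm : ‖(√(n : ℝ))⁻¹ • V n ω‖ = ‖V n ω‖ / √n := by
    rw [norm_smul, norm_inv, Real.norm_of_nonneg hs.le, inv_mul_eq_div]
  have h1 : dist ((√(n : ℝ))⁻¹ • V n ω) 0 < η := by
    rw [dist_zero_right, hnorm, div_lt_iff₀ hs]
    rw [div_lt_iff₀ hη] at hnη
    linarith
  have h2 := hball h1
  rw [hnorm] at h2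
  have h3 : √n * (f (x + (√n)⁻¹ • V n ω) - f x) - L (V n ω) =
      √n * (f (x + (√n)⁻¹ • V n ω) - f x - L ((√(n : ℝ))⁻¹ • V n ω)) := by
    rw [map_smul, smul_eq_mul]
    field_simp
  have h4 : ε ≤ ‖√n * (f (x + (√n)⁻¹ • V n ω) - f x) - L (V n ω)‖ := by simpa using hω
  rw [h3, norm_mul, Real.norm_of_nonneg hs.le] at h4
  have h5 : √n * (ε / (2 * K) * (‖V n ω‖ / √n)) = ε / 2 * (‖V n ω‖ / K) := by field_simp
  have h6 : ‖V n ω‖ / K < 1 := (div_lt_one hK).2 hVK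
  have h7 := mul_le_mul_of_nonneg_left h2 hs.le
  nlinarith

lemma hasFDerivAt_rpow_mul_rpow (a b : ℝ) :
    HasFDerivAt (fun x : ℝ × ℝ => x.1 ^ a * x.2 ^ b)
      (a • ContinuousLinearMap.fst ℝ ℝ ℝ + b • ContinuousLinearMap.snd ℝ ℝ ℝ) (1, 1) := by
  have h1 : HasFDerivAt (fun x : ℝ × ℝ => x.1 ^ a)
      ((a * 1 ^ (a - 1)) • ContinuousLinearMap.fst ℝ ℝ ℝ) (1, 1) :=
    (hasFDerivAt_fst (𝕜 := ℝ) (p := ((1 : ℝ), (1 : ℝ)))).rpow_const (Or.inl one_ne_zero)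
  have h2 : HasFDerivAt (fun x : ℝ × ℝ => x.2 ^ b)
      ((b * 1 ^ (b - 1)) • ContinuousLinearMap.snd ℝ ℝ ℝ) (1, 1) :=
    (hasFDerivAt_snd (𝕜 := ℝ) (p := ((1 : ℝ), (1 : ℝ)))).rpow_const (Or.inl one_ne_zero)
  refine (h1.mul h2).congr_fderiv ?_
  simp [add_comm]

/-- The influence function whose normalized sums govern the fluctuations of the `q`-norm. -/
noncomputable def influence (p q x : ℝ) : ℝ := |x| ^ q / Mp p q * (1 / q) - |x| ^ p * (1 / p)

lemma memLp_influence {p q : ℝ} (hp : 0 < p) (hq : 0 < q) :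
    MemLp (influence p q) 2 (genGauss p) := by
  have h1 := ((memLp_two_abs_rpow_genGauss hp hq.le).mul_const (Mp p q)⁻¹).mul_const (1 / q)
  have h2 := (memLp_two_abs_rpow_genGauss hp hp.le).mul_const (1 / p)
  exact h1.sub h2

lemma integral_influence {p q : ℝ} (hp : 0 < p) (hq : 0 < q) :
    ∫ x, influence p q x ∂(genGauss p) = 1 / q - 1 / p := by
  have hM := Mp_pos hp hq.le
  unfold influence
  rw [integral_sub (((integrable_abs_rpow_genGauss hp hq.le).div_const _).mul_const _)
    ((integrable_abs_rpow_genGauss hp hp.le).mul_const _), integral_mul_const, integral_mul_const,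
    integral_div, integral_abs_rpow_genGauss hp hq.le, integral_abs_rpow_genGauss hp hp.le,
    Mp_self hp, div_self hM.ne', one_mul, one_mul]

lemma variance_influence {p q : ℝ} (hp : 0 < p) (hq : 0 < q) :
    Var[influence p q; genGauss p] = sigmaSq p q := by
  have := isProbabilityMeasure_genGauss hp
  have hM := Mp_pos hp hq.le
  have hi : ∀ r : ℝ, 0 ≤ r → Integrable (fun x => |x| ^ r) (genGauss p) :=
    fun r hr => integrable_abs_rpow_genGauss hp hr
  have hsq : ∀ x, (influence p q ^ 2) x = (Mp p q * q)⁻¹ ^ 2 * |x| ^ (q + q) -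
      2 * (Mp p q * q * p)⁻¹ * |x| ^ (p + q) + p⁻¹ ^ 2 * |x| ^ (p + p) := fun x => by
    rw [Real.rpow_add_of_nonneg (abs_nonneg x) hq.le hq.le,
      Real.rpow_add_of_nonneg (abs_nonneg x) hp.le hq.le,
      Real.rpow_add_of_nonneg (abs_nonneg x) hp.le hp.le, Pi.pow_apply, influence]
    field_simp
    ring
  have hint : ∫ x, (influence p q ^ 2) x ∂(genGauss p) = (Mp p q * q)⁻¹ ^ 2 * Mp p (q + q) -
      2 * (Mp p q * q * p)⁻¹ * Mp p (p + q) + p⁻¹ ^ 2 * Mp p (p + p) := by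
    have h1 := (hi (q + q) (by positivity)).const_mul ((Mp p q * q)⁻¹ ^ 2)
    have h2 := (hi (p + q) (by positivity)).const_mul (2 * (Mp p q * q * p)⁻¹)
    have h3 := (hi (p + p) (by positivity)).const_mul (p⁻¹ ^ 2)
    have h12 : Integrable (fun x => (Mp p q * q)⁻¹ ^ 2 * |x| ^ (q + q) -
        2 * (Mp p q * q * p)⁻¹ * |x| ^ (p + q)) (genGauss p) := h1.sub h2
    rw [integral_congr_ae (ae_of_all _ hsq), integral_add h12 h3, integral_sub h1 h2,
      integral_const_mul, integral_const_mul, integral_const_mul,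
      integral_abs_rpow_genGauss hp (by positivity), integral_abs_rpow_genGauss hp (by positivity),
      integral_abs_rpow_genGauss hp (by positivity)]
  rw [variance_eq_sub (memLp_influence hp hq), integral_influence hp hq, hint, sigmaSq, Cp, Cp, Cp,
    Mp_self hp]
  generalize Mp p q = M at *
  field_simp
  ring

lemma scaled_ratio_eq {p q n a b : ℝ} (hp : 0 < p) (hq : 0 < q) (hn : 0 < n) (ha : 0 ≤ a)
    (hb : 0 ≤ b) :
    n ^ (1 / p - 1 / q) * (b ^ (-(1 / p)) * a ^ (1 / q)) / mpq p q =
      (a / Mp p q / n) ^ (1 / q) * (b / n) ^ (-(1 / p)) := by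
  have hM := Mp_pos hp hq.le
  rw [mpq, Real.div_rpow (by positivity) hn.le, Real.div_rpow ha hM.le, Real.div_rpow hb hn.le,
    Real.rpow_neg hn.le, Real.rpow_sub hn]
  have := Real.rpow_pos_of_pos hn (1 / q)
  have := Real.rpow_pos_of_pos hM (1 / q)
  field_simp

/-- Central limit theorem for the probabilistic representation of the rescaled `q`-norm. -/
theorem tendstoInDistribution_scaled_ratio {Ω : Type*} [MeasurableSpace Ω] {μ : Measure Ω}
    [IsProbabilityMeasure μ] {p q : ℝ} (hp : 0 < p) (hq : 0 < q) {Z : ℕ → Ω → ℝ} {E : Ω → ℝ}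
    (hZ : ∀ k, Measurable (Z k)) (hlaw : ∀ k, μ.map (Z k) = genGauss p) (hindep : iIndepFun Z μ)
    (hE : Measurable E) (hE0 : ∀ᵐ ω ∂μ, 0 ≤ E ω) :
    TendstoInDistribution (fun (n : ℕ) ω => √n * ((n : ℝ) ^ (1 / p - 1 / q) *
      ((∑ k ∈ Finset.range n, |Z k ω| ^ p + E ω) ^ (-(1 / p)) *
        (∑ k ∈ Finset.range n, |Z k ω| ^ q) ^ (1 / q)) / mpq p q - 1))
      atTop id (fun _ => μ) (gaussianReal 0 (sigmaSq p q).toNNReal) := by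
  have hM := Mp_pos hp hq.le
  have hident : ∀ k, IdentDistrib (Z k) (Z 0) μ μ := fun k =>
    ⟨(hZ k).aemeasurable, (hZ 0).aemeasurable, (hlaw k).trans (hlaw 0).symm⟩
  have hid : IdentDistrib (Z 0) id μ (genGauss p) :=
    ⟨(hZ 0).aemeasurable, aemeasurable_id, by rw [hlaw 0, Measure.map_id]⟩
  have hinf : Measurable (influence p q) := by unfold influence; fun_prop
  have hW := tendstoInDistribution_inv_sqrt_mul_sum_sub (P := μ)
    (P' := gaussianReal 0 (sigmaSq p q).toNNReal) (Y := id)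
    (X := fun k ω => influence p q (Z k ω))
    ⟨aemeasurable_id, by
      rw [Measure.map_id, ← variance_influence hp hq]
      exact congrArg (fun v : ℝ => gaussianReal 0 v.toNNReal) (hid.comp hinf).variance_eq.symm⟩
    ((hid.comp hinf).symm.memLp_snd (memLp_influence hp hq))
    (hindep.comp (fun _ => influence p q) fun _ => hinf)
    (fun k => (hident k).comp hinf)
  have hWmean : ∫ ω, influence p q (Z 0 ω) ∂μ = 1 / q - 1 / p :=
    (hid.comp hinf).integral_eq.trans (integral_influence hp hq)
  have hbdd : ∀ r : ℝ, 0 < r → BoundedInProb μ fun n ω =>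
      (√n)⁻¹ * (∑ k ∈ Finset.range n, |Z k ω| ^ r / Mp p r - n) := fun r hr => by
    have hm : Measurable fun x : ℝ => |x| ^ r / Mp p r := by fun_prop
    have h := boundedInProb_inv_sqrt_mul_sum_sub (μ := μ) (X := fun k ω => |Z k ω| ^ r / Mp p r)
      ((hid.comp hm).symm.memLp_snd
        ((memLp_two_abs_rpow_genGauss hp hr.le).mul_const (Mp p r)⁻¹))
      (hindep.comp (fun _ x => |x| ^ r / Mp p r) fun _ => hm)
      (fun k => (hident k).comp hm)
    have hmean : ∫ ω, |Z 0 ω| ^ r / Mp p r ∂μ = 1 := by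
      refine (hid.comp hm).integral_eq.trans ?_
      change ∫ x, |x| ^ r / Mp p r ∂(genGauss p) = 1
      rw [integral_div, integral_abs_rpow_genGauss hp hr.le, div_self (Mp_pos hp hr.le).ne']
    simpa only [hmean, mul_one] using h
  have hsq : Tendsto (fun n : ℕ => (√(n : ℝ))⁻¹) atTop (𝓝 0) :=
    (Real.tendsto_sqrt_atTop.comp tendsto_natCast_atTop_atTop).inv_tendsto_atTop
  have hE1 : ∀ c : ℝ, TendstoInMeasure μ (fun (n : ℕ) ω => (√n)⁻¹ * E ω * c) atTop 0 := fun c =>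
    tendstoInMeasure_of_tendsto_ae (fun n => (by fun_prop : Measurable _).aestronglyMeasurable)
      (ae_of_all _ fun ω => by simpa using (hsq.mul_const (E ω)).mul_const c)
  have hV := (hbdd q hq).prodMk ((hbdd p hp).add
    (boundedInProb_of_tendstoInMeasure (by simpa only [mul_one] using hE1 1)))
  have hdelta := hV.tendstoInMeasure_delta (hasFDerivAt_rpow_mul_rpow (1 / q) (-(1 / p)))
  refine tendstoInDistribution_of_tendstoInMeasure_sub _ _
    (tendstoInDistribution_of_tendstoInMeasure_sub (fun (n : ℕ) ω =>
      ((1 / q) • ContinuousLinearMap.fst ℝ ℝ ℝ + (-(1 / p)) • ContinuousLinearMap.snd ℝ ℝ ℝ)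
        ((√n)⁻¹ * (∑ k ∈ Finset.range n, |Z k ω| ^ q / Mp p q - n),
          (√n)⁻¹ * (∑ k ∈ Finset.range n, |Z k ω| ^ p / Mp p p - n) + (√n)⁻¹ * E ω))
      _ hW ((hE1 (-(1 / p))).congr_left fun n => ae_of_all _ fun ω => ?_)
      fun n => ?_) (hdelta.congr' ?_ (ae_eq_refl _)) fun n => ?_
  · simp only [Pi.sub_apply, hWmean]
    simp only [influence, Mp_self hp, Finset.sum_sub_distrib,
      ← Finset.sum_mul, _root_.add_apply, _root_.smul_apply,
      ContinuousLinearMap.coe_fst', ContinuousLinearMap.coe_snd', smul_eq_mul, div_one]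
    ring
  · simp only [_root_.add_apply, _root_.smul_apply,
      ContinuousLinearMap.coe_fst', ContinuousLinearMap.coe_snd', smul_eq_mul]
    exact (by fun_prop : Measurable _).aemeasurable
  · filter_upwards [eventually_gt_atTop 0] with n hn
    filter_upwards [hE0] with ω hω
    have hn' : (0 : ℝ) < n := by exact_mod_cast hn
    rw [Pi.sub_apply, Pi.sub_apply]
    congr 2
    rw [scaled_ratio_eq hp hq hn' (by positivity) (by positivity)]
    have hs : (√(n : ℝ))⁻¹ * (√(n : ℝ))⁻¹ = (n : ℝ)⁻¹ := by
      rw [← mul_inv, Real.mul_self_sqrt hn'.le]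
    simp only [Prod.smul_mk, Prod.mk_add_mk, smul_eq_mul, Real.one_rpow, mul_one, mul_add,
      ← mul_assoc, hs, Mp_self hp, div_one, ← Finset.sum_div]
    congr 3
    · field_simp
      ring
    · field_simp
      ring
  · exact (by fun_prop : Measurable _).aemeasurable

lemma iIndepFun_eval_prod {γ ρ : Measure ℝ} [IsProbabilityMeasure γ] [IsProbabilityMeasure ρ] :
    iIndepFun (fun (k : ℕ) (ω : (ℕ → ℝ) × ℝ) => ω.1 k)
      ((Measure.infinitePi fun _ : ℕ => γ).prod ρ) := by
  rw [iIndepFun_iff_map_fun_eq_infinitePi_map (by fun_prop)]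
  have h : ∀ k : ℕ, ((Measure.infinitePi fun _ : ℕ => γ).prod ρ).map (fun ω => ω.1 k) = γ :=
    fun k => ((measurePreserving_eval_infinitePi (fun _ : ℕ => γ) k).comp
      measurePreserving_fst).map_eq
  simp_rw [h]
  exact measurePreserving_fst.map_eq

lemma measurePreserving_eval_fin_prod {γ ρ : Measure ℝ} [IsProbabilityMeasure γ]
    [IsProbabilityMeasure ρ] (n : ℕ) :
    MeasurePreserving (fun ω : (ℕ → ℝ) × ℝ => ((fun i : Fin n => ω.1 i), ω.2))
      ((Measure.infinitePi fun _ : ℕ => γ).prod ρ) ((Measure.pi fun _ : Fin n => γ).prod ρ) := by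
  have h : MeasurePreserving (fun (ω : ℕ → ℝ) (i : Fin n) => ω i)
      (Measure.infinitePi fun _ : ℕ => γ) (Measure.pi fun _ : Fin n => γ) :=
    ⟨by fun_prop, (Measure.map_infinitePi_infinitePi_of_inj (P := fun _ : ℕ => γ)
      (f := fun i : Fin n => (i : ℕ)) Fin.val_injective).trans
        (Measure.infinitePi_eq_pi _)⟩
  exact h.prod (MeasurePreserving.id ρ)

lemma pnorm_smul {n : ℕ} {q c : ℝ} (hq : 0 < q) (hc : 0 ≤ c) (x : Fin n → ℝ) :
    pnorm q (c • x) = c * (∑ i, |x i| ^ q) ^ (1 / q) := by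
  simp only [pnorm, Pi.smul_apply, smul_eq_mul, abs_mul, abs_of_nonneg hc,
    Real.mul_rpow hc (abs_nonneg _), ← Finset.mul_sum]
  rw [Real.mul_rpow (by positivity) (by positivity), ← Real.rpow_mul hc,
    mul_one_div_cancel hq.ne', Real.rpow_one]

lemma ae_nonneg_expMeasure (r : ℝ) : ∀ᵐ x ∂(expMeasure r), 0 ≤ x := by
  have hm : Measurable (exponentialPDF r) := (measurable_exponentialPDFReal r).ennreal_ofReal
  refine (ae_withDensity_iff hm).2 ?_
  refine ae_of_all _ fun x hx => ?_
  by_contra h0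
  exact hx (by rw [exponentialPDF_eq, if_neg h0, ENNReal.ofReal_zero])

/-- Central limit theorem for the `q`-norm of a random point uniformly distributed in
`𝔹_p^n`: `√n (n^{1/p−1/q} ‖X‖_q / m_{p,q} − 1)` converges in distribution to a centred
Gaussian with variance `σ²_{p,q}` (convergence in distribution is expressed by
convergence of integrals of bounded continuous test functions). -/
theorem clt_qnorm_uniform_lp_ball (p q : ℝ) (hp : 0 < p) (hq : 0 < q) (hpq : p ≠ q) :
    ∀ g : BoundedContinuousFunction ℝ ℝ,
      Tendsto (fun n : ℕ =>
          ∫ x, g (Real.sqrt n * ((n : ℝ) ^ (1 / p - 1 / q) * pnorm q x / mpq p q - 1))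
            ∂(nuMeasure n p))
        atTop
        (𝓝 (∫ y, g y ∂(ProbabilityTheory.gaussianReal 0 (sigmaSq p q).toNNReal))) := by
  intro g
  have := isProbabilityMeasure_genGauss hp
  have := isProbabilityMeasure_expMeasure (inv_pos.2 hp)
  set γ := genGauss p
  set ρ := expMeasure p⁻¹
  set μ : Measure ((ℕ → ℝ) × ℝ) := (Measure.infinitePi fun _ : ℕ => γ).prod ρ
  have hE0 : ∀ᵐ ω ∂μ, 0 ≤ ω.2 :=
    (measurePreserving_snd (μ := Measure.infinitePi fun _ : ℕ => γ)).quasiMeasurePreserving.ae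
      (ae_nonneg_expMeasure _)
  have hdist := tendstoInDistribution_scaled_ratio (μ := μ) hp hq
    (Z := fun k ω => ω.1 k) (E := Prod.snd) (fun k => by fun_prop)
    (fun k => ((measurePreserving_eval_infinitePi (fun _ : ℕ => γ) k).comp
      measurePreserving_fst).map_eq) iIndepFun_eval_prod measurable_snd hE0
  have hlim := ProbabilityMeasure.tendsto_iff_forall_integral_tendsto.1 hdist.tendsto g
  simp only [ProbabilityMeasure.coe_mk, Measure.map_id] at hlim
  have hg : ∀ n : ℕ, Measurable fun x : Fin n → ℝ =>
      g (√n * ((n : ℝ) ^ (1 / p - 1 / q) * pnorm q x / mpq p q - 1)) := fun n =>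
    g.continuous.measurable.comp (by unfold pnorm; fun_prop)
  refine hlim.congr fun n => ?_
  rw [integral_map (hdist.forall_aemeasurable n) g.continuous.aestronglyMeasurable,
    ← map_prod_expMeasure_eq_nuMeasure hp n, ← (measurePreserving_eval_fin_prod n).map_eq,
    Measure.map_map (by fun_prop) (by fun_prop), integral_map (by fun_prop)
      (hg n).aestronglyMeasurable]
  refine integral_congr_ae ?_
  filter_upwards [hE0] with ω hω
  have hc : 0 ≤ (∑ i : Fin n, |ω.1 i| ^ p + ω.2) ^ (-(1 / p)) := by positivity
  simp only [Function.comp_apply]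
  rw [pnorm_smul hq hc, Fin.sum_univ_eq_sum_range (fun k => |ω.1 k| ^ p),
    Fin.sum_univ_eq_sum_range (fun k => |ω.1 k| ^ q)]
end
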